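/- Transfer inequality for maps of bounded distortion for triangles: let (T,d) be a metric space, x₀ ∈ T, and define i_{x₀}(y,z) = exp(−2⟨y,z⟩_{x₀}). If ω : T → T is a mapping of bounded distortion for triangles with constants D₁ ≥ 1 and D₂ ≥ 0, then for all y, z ∈ T, e^{−2D₂} · J_{x₀}(y,z) · i_{x₀}(y,z)^{D₁} ≤ i_{x₀}(ω(y), ω(z)) ≤ e^{2D₂} · J_{x₀}(y,z) · i_{x₀}(y,z)^{1/D₁}, where J_{x₀}(y,z) = e^{2 d(x₀, ω(x₀))} · i_{x₀}(ω(x₀), ω(y)) · i_{x₀}(ω(x₀), ω(z)). -/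

import Mathlib

/-- The Gromov product `⟨y,z⟩ₓ = (d(x,y) + d(x,z) − d(y,z))/2` in a metric space. -/
noncomputable def gromovProduct {T : Type*} [MetricSpace T] (x y z : T) : ℝ :=
  (dist x y + dist x z - dist y z) / 2

/-- The exponentiated Gromov product `i_{x₀}(y,z) = exp(−2⟨y,z⟩_{x₀})`. -/
noncomputable def iProd {T : Type*} [MetricSpace T] (x₀ y z : T) : ℝ :=
  Real.exp (-2 * gromovProduct x₀ y z)

/-- Change of basepoint for the Gromov product. -/
theorem gromovProduct_change_base {T : Type*} [MetricSpace T] (o p a b : T) :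
    gromovProduct o a b =
      gromovProduct p a b + gromovProduct o p a + gromovProduct o p b - dist o p := by
  simp only [gromovProduct]
  ring

/-- Transfer inequality for maps of bounded distortion for triangles:
`e^{−2D₂} J_{x₀}(y,z) i_{x₀}(y,z)^{D₁} ≤ i_{x₀}(ω y, ω z) ≤ e^{2D₂} J_{x₀}(y,z) i_{x₀}(y,z)^{1/D₁}`,
where `J_{x₀}(y,z) = e^{2 d(x₀, ω x₀)} i_{x₀}(ω x₀, ω y) i_{x₀}(ω x₀, ω z)`. -/
theorem iProd_transfer {T : Type*} [MetricSpace T] (x₀ : T) (ω : T → T)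
    (D₁ D₂ : ℝ) (hD₁ : 1 ≤ D₁) (hD₂ : 0 ≤ D₂)
    (hω : ∀ x y z : T,
      (1 / D₁) * gromovProduct z x y - D₂ ≤ gromovProduct (ω z) (ω x) (ω y) ∧
      gromovProduct (ω z) (ω x) (ω y) ≤ D₁ * gromovProduct z x y + D₂) :
    ∀ y z : T,
      Real.exp (-2 * D₂) *
          (Real.exp (2 * dist x₀ (ω x₀)) * iProd x₀ (ω x₀) (ω y) * iProd x₀ (ω x₀) (ω z)) *
          iProd x₀ y z ^ D₁
        ≤ iProd x₀ (ω y) (ω z) ∧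
      iProd x₀ (ω y) (ω z)
        ≤ Real.exp (2 * D₂) *
            (Real.exp (2 * dist x₀ (ω x₀)) * iProd x₀ (ω x₀) (ω y) * iProd x₀ (ω x₀) (ω z)) *
            iProd x₀ y z ^ (1 / D₁) := by
  intro y z
  obtain ⟨lower, upper⟩ := hω y z x₀
  have change_base := gromovProduct_change_base x₀ (ω x₀) (ω y) (ω z)
  simp only [iProd, ← Real.exp_mul, ← Real.exp_add, Real.exp_le_exp]
  constructor <;> linarith
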